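/- Let M be an n×n real symmetric positive definite tridiagonal matrix with smallest eigenvalue λ_min and largest eigenvalue λ_max, λ_min < λ_max, let κ = λ_max/λ_min, and let S = M ⊗ I_n + I_n ⊗ M. For k, t ∈ {1, …, n²} set j = ⌊(t−1)/n⌋ + 1, i = t − n⌊(t−1)/n⌋, m = ⌊(k−1)/n⌋ + 1, ℓ = k − n⌊(k−1)/n⌋, and let 𝔫₂ = |ℓ − i| + |m − j| − 2. If ℓ ≠ i, m ≠ j and 𝔫₂ > 0, then |(S⁻¹)_{k,t}| ≤ (√(κ² + 1)/(2 λ_min)) · (1/√𝔫₂). -/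

import Mathlib

open MeasureTheory Real Matrix

/-- The Kronecker sum `S = M ⊗ Iₙ + Iₙ ⊗ M`, written entrywise with 0-based
indices: for `k, t ∈ Fin (n*n)`, the row grid index is `k % n` and the column
grid index is `k / n` (vec convention stacking columns). -/
noncomputable def kronSum (n : ℕ) (M : Matrix (Fin n) (Fin n) ℝ) :
    Matrix (Fin (n * n)) (Fin (n * n)) ℝ := fun k t =>
  have hn : 0 < n := by
    rcases Nat.eq_zero_or_pos n with h | h
    · subst h; exact absurd k.2 (by simp)
    · exact h
  (if (k : ℕ) / n = (t : ℕ) / n then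
      M ⟨(k : ℕ) % n, Nat.mod_lt _ hn⟩ ⟨(t : ℕ) % n, Nat.mod_lt _ hn⟩
    else 0) +
  (if (k : ℕ) % n = (t : ℕ) % n then
      M ⟨(k : ℕ) / n, Nat.div_lt_of_lt_mul k.2⟩ ⟨(t : ℕ) / n, Nat.div_lt_of_lt_mul t.2⟩
    else 0)

open scoped Kronecker

namespace Matrix

variable {ι : Type*} [Fintype ι] [DecidableEq ι]

/-- A matrix that is banded for a graph-like distance `δ` has powers with growing bandwidth. -/
theorem pow_apply_eq_zero_of_banded {δ : ι → ι → ℤ} (hself : ∀ x, δ x x = 0)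
    (htriangle : ∀ x y z, δ x z ≤ δ x y + δ y z) {B : Matrix ι ι ℝ}
    (hB : ∀ x y, 1 < δ x y → B x y = 0) (r : ℕ) (x y : ι) (hr : (r : ℤ) < δ x y) :
    (B ^ r) x y = 0 := by
  induction r generalizing y with
  | zero =>
    have hxy : x ≠ y := by
      rintro rfl
      simp [hself] at hr
    simp [one_apply_ne hxy]
  | succ r ih =>
    rw [pow_succ, mul_apply]
    refine Finset.sum_eq_zero fun z _ => ?_
    by_cases hz : (r : ℤ) < δ x z
    · rw [ih z hz, zero_mul]
    · rw [hB z y, mul_zero]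
      have := htriangle x z y
      push_cast at hr
      linarith

theorem abs_mul_diagonal_mul_star_apply_le {W : Matrix ι ι ℝ} (hW : W * star W = 1) {f : ι → ℝ}
    {C : ℝ} (hf : ∀ p, |f p| ≤ C) (x y : ι) : |(W * diagonal f * star W) x y| ≤ C := by
  have hrow (z : ι) : ∑ p, W z p ^ 2 = 1 := by
    have := congrFun (congrFun hW z) z
    simpa [mul_apply, star_apply, sq] using this
  rw [mul_apply]
  simp only [mul_diagonal, star_apply, star_trivial]
  calc |∑ p, W x p * f p * W y p| ≤ ∑ p, |W x p * f p * W y p| := Finset.abs_sum_le_sum_abs _ _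
    _ ≤ ∑ p, C * ((W x p ^ 2 + W y p ^ 2) / 2) := by
      refine Finset.sum_le_sum fun p _ => ?_
      have hC : 0 ≤ C := (abs_nonneg _).trans (hf p)
      have hmean : |W x p| * |W y p| ≤ (W x p ^ 2 + W y p ^ 2) / 2 := by
        rw [← sq_abs (W x p), ← sq_abs (W y p)]
        linarith [two_mul_le_add_sq |W x p| |W y p|]
      calc |W x p * f p * W y p| = |f p| * (|W x p| * |W y p|) := by
            rw [abs_mul, abs_mul]; ring
        _ ≤ _ := mul_le_mul (hf p) hmean (by positivity) hC
    _ = C := by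
      rw [← Finset.mul_sum, ← Finset.sum_div, Finset.sum_add_distrib, hrow, hrow]
      ring

/-- Exponential decay of the inverse of a banded, orthogonally diagonalized matrix with spectrum
in `[α, β]`. -/
theorem abs_inv_apply_le_of_banded {δ : ι → ι → ℤ} (hself : ∀ x, δ x x = 0)
    (htriangle : ∀ x y z, δ x z ≤ δ x y + δ y z) {A W : Matrix ι ι ℝ} {a : ι → ℝ}
    (hA : ∀ x y, 1 < δ x y → A x y = 0) (hW : W ∈ unitary (Matrix ι ι ℝ))
    (hAW : A = W * diagonal a * star W) {α β : ℝ} (hα : 0 < α)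
    (ha : ∀ p, a p ∈ Set.Icc α β) (x y : ι) (d : ℕ) (hd : (d : ℤ) ≤ δ x y) :
    |A⁻¹ x y| ≤ ((β - α) / (β + α)) ^ d / α := by
  obtain ⟨hW₁, hW₂⟩ := Unitary.mem_iff.mp hW
  have hαβ : α ≤ β := (ha x).1.trans (ha x).2
  have hsum : 0 < β + α := by linarith
  have hmul (f g : ι → ℝ) : (W * diagonal f * star W) * (W * diagonal g * star W) =
      W * diagonal (fun p => f p * g p) * star W := by
    rw [← diagonal_mul_diagonal]
    calc _ = W * diagonal f * (star W * W) * diagonal g * star W := by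
          simp only [Matrix.mul_assoc]
      _ = _ := by rw [hW₁]; simp only [Matrix.mul_assoc, Matrix.one_mul]
  have hone : W * diagonal (fun _ => (1 : ℝ)) * star W = 1 := by
    rw [diagonal_one, Matrix.mul_one, hW₂]
  have hpow (f : ι → ℝ) (r : ℕ) : (W * diagonal f * star W) ^ r =
      W * diagonal (fun p => f p ^ r) * star W := by
    induction r with
    | zero => simp [hW₂]
    | succ r ih => rw [pow_succ, ih, hmul]; simp only [pow_succ]
  have hapos (p : ι) : 0 < a p := hα.trans_le (ha p).1
  have hinv : W * diagonal (fun p => (a p)⁻¹) * star W * A = 1 := by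
    rw [hAW, hmul, ← hone]
    simp only [inv_mul_cancel₀ (hapos _).ne']
  have hAinv : A⁻¹ = W * diagonal (fun p => (a p)⁻¹) * star W := inv_eq_left_inv hinv
  set c : ℝ := 2 / (β + α) with hc
  set B : Matrix ι ι ℝ := 1 - c • A with hB
  have hBW : B = W * diagonal (fun p => 1 - c * a p) * star W := by
    have : diagonal (fun p => 1 - c * a p) = 1 - c • diagonal a := by
      rw [← diagonal_one, ← diagonal_smul, diagonal_sub]
      rfl
    rw [this, hB, hAW, Matrix.mul_sub, Matrix.sub_mul, Matrix.mul_one, hW₂, Matrix.mul_smul,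
      Matrix.smul_mul]
  have hBband (u v : ι) (huv : 1 < δ u v) : B u v = 0 := by
    have hne : u ≠ v := by
      rintro rfl
      simp [hself] at huv
    simp [hB, one_apply_ne hne, hA u v huv]
  have hgeom : (c • ∑ r ∈ Finset.range d, B ^ r) = A⁻¹ - B ^ d * A⁻¹ := by
    have h := geom_sum_mul_neg B d
    have h1 : 1 - B = c • A := by simp [hB]
    rw [h1] at h
    have hAA : A * A⁻¹ = 1 := by
      rw [hAinv]
      exact mul_eq_one_comm.mp hinv
    calc _ = (∑ r ∈ Finset.range d, B ^ r) * (c • A) * A⁻¹ := by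
          rw [Matrix.mul_smul, Matrix.smul_mul, Matrix.mul_assoc, hAA, Matrix.mul_one]
      _ = _ := by rw [h, Matrix.sub_mul, Matrix.one_mul]
  have hzero : (c • ∑ r ∈ Finset.range d, B ^ r) x y = 0 := by
    rw [smul_apply, sum_apply, Finset.sum_eq_zero, smul_zero]
    intro r hr
    refine pow_apply_eq_zero_of_banded hself htriangle hBband r x y (lt_of_lt_of_le ?_ hd)
    exact_mod_cast Finset.mem_range.mp hr
  have hentry : A⁻¹ x y = (B ^ d * A⁻¹) x y := by
    rw [hgeom, sub_apply] at hzero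
    linarith
  rw [hentry, hBW, hpow, hAinv, hmul]
  refine abs_mul_diagonal_mul_star_apply_le hW₂ (fun p => ?_) x y
  rw [abs_mul, abs_pow, abs_inv, abs_of_pos (hapos p), div_eq_mul_inv]
  have hcontr : |1 - c * a p| ≤ (β - α) / (β + α) := by
    have hrw : 1 - c * a p = (β + α - 2 * a p) / (β + α) := by
      rw [hc]; field_simp
    rw [hrw, abs_div, abs_of_pos hsum]
    gcongr
    rw [abs_le]
    constructor <;> linarith [(ha p).1, (ha p).2]
  have := (hapos p).le
  gcongr
  exact (ha p).1

/-- The Kronecker sum of an orthogonally diagonalized matrix with itself. -/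
theorem kroneckerSum_eq_conj_diagonal {M U : Matrix ι ι ℝ} {f : ι → ℝ}
    (hU : U ∈ unitary (Matrix ι ι ℝ)) (hM : M = U * diagonal f * star U) :
    1 ⊗ₖ M + M ⊗ₖ 1 = (U ⊗ₖ U) * diagonal (fun p => f p.2 + f p.1) * star (U ⊗ₖ U) := by
  have hU₂ : 1 = U * diagonal (fun _ => 1) * star U := by
    rw [diagonal_one, Matrix.mul_one, (Unitary.mem_iff.mp hU).2]
  have hdiag : diagonal (fun p : ι × ι => f p.2 + f p.1) =
      diagonal (fun _ => 1) ⊗ₖ diagonal f + diagonal f ⊗ₖ diagonal (fun _ => 1) := by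
    simp only [diagonal_kronecker_diagonal, diagonal_add, one_mul, mul_one]
  have hstar : star (U ⊗ₖ U) = star U ⊗ₖ star U := conjTranspose_kronecker U U
  rw [hdiag, hstar, Matrix.mul_add, Matrix.add_mul]
  simp only [← mul_kronecker_mul]
  rw [← hU₂, ← hM]

end Matrix

theorem kronSum_eq_submatrix (n : ℕ) (M : Matrix (Fin n) (Fin n) ℝ) :
    kronSum n M = ((1 : Matrix (Fin n) (Fin n) ℝ) ⊗ₖ M + M ⊗ₖ 1).submatrix
      finProdFinEquiv.symm finProdFinEquiv.symm := by
  ext k t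
  simp only [kronSum, submatrix_apply, Matrix.add_apply, kroneckerMap_apply, one_apply, ite_mul, one_mul,
    zero_mul, mul_ite, mul_one, mul_zero, Fin.ext_iff, finProdFinEquiv_symm_apply, Fin.coe_divNat,
    Fin.coe_modNat]
  rfl

theorem nat_mul_pow_le {σ : ℝ} (h₀ : 0 ≤ σ) (h₁ : σ ≤ 1) (d : ℕ) :
    d * (1 - σ) * σ ^ d ≤ 1 - σ ^ d := by
  induction d with
  | zero => simp
  | succ d ih =>
    have h := mul_le_mul_of_nonneg_left ih h₀
    have hp : (1 - σ) * σ ^ (d + 1) ≤ 1 - σ :=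
      mul_le_of_le_one_right (by linarith) (pow_le_one₀ h₀ h₁)
    push_cast
    rw [pow_succ] at hp ⊢
    linarith

theorem pow_mul_sqrt_le {κ : ℝ} (hκ : 1 ≤ κ) (d : ℕ) :
    ((κ - 1) / (κ + 1)) ^ d * √d ≤ √(κ ^ 2 + 1) := by
  set σ := (κ - 1) / (κ + 1) with hσ
  have h₀ : 0 ≤ σ := div_nonneg (by linarith) (by linarith)
  have h₁ : σ ≤ 1 := (div_le_one (by linarith)).mpr (by linarith)
  have hpow₀ : 0 ≤ σ ^ d := pow_nonneg h₀ d
  have hpow₁ : σ ^ d ≤ 1 := pow_le_one₀ h₀ h₁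
  have hgap : 1 - σ = 2 / (κ + 1) := by
    rw [hσ]; field_simp; ring
  have hd : d * σ ^ d ≤ (κ + 1) / 2 := by
    have h := nat_mul_pow_le h₀ h₁ d
    have h' : d * σ ^ d * (2 / (κ + 1)) ≤ 1 := by rw [← hgap]; linarith
    rw [mul_div_assoc', div_le_one (by linarith)] at h'
    linarith
  refine Real.le_sqrt_of_sq_le ?_
  rw [mul_pow, Real.sq_sqrt (Nat.cast_nonneg d)]
  calc (σ ^ d) ^ 2 * d = σ ^ d * (d * σ ^ d) := by ring
    _ ≤ d * σ ^ d := mul_le_of_le_one_left (by positivity) hpow₁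
    _ ≤ (κ + 1) / 2 := hd
    _ ≤ κ ^ 2 + 1 := by nlinarith

/-- Proposition 2.4 (i): asymptotic bound `|S⁻¹_{k,t}| ≤ √(κ²+1)/(2λ_min) · 𝔫₂^{-1/2}`
when both grid coordinates differ. -/
theorem kronSum_inv_entry_asymptotic_bound_offdiag
    (n : ℕ) (M : Matrix (Fin n) (Fin n) ℝ) (hM : M.PosDef)
    (htri : ∀ a c : Fin n, 1 < |(a : ℤ) - (c : ℤ)| → M a c = 0)
    (lammin lammax κ : ℝ)
    (hmin : IsLeast (Set.range hM.1.eigenvalues) lammin)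
    (hmax : IsGreatest (Set.range hM.1.eigenvalues) lammax)
    (hlt : lammin < lammax) (hκ : κ = lammax / lammin)
    (k t : ℕ) (hk1 : 1 ≤ k) (hk2 : k ≤ n * n) (ht1 : 1 ≤ t) (ht2 : t ≤ n * n)
    (i j ℓ m : ℕ)
    (hj : j = (t - 1) / n + 1) (hi : i = t - n * ((t - 1) / n))
    (hm : m = (k - 1) / n + 1) (hl : ℓ = k - n * ((k - 1) / n))
    (hne1 : ℓ ≠ i) (hne2 : m ≠ j)
    (𝔫 : ℝ) (h𝔫 : 𝔫 = |(ℓ : ℝ) - (i : ℝ)| + |(m : ℝ) - (j : ℝ)| - 2)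
    (h𝔫pos : 0 < 𝔫) :
    |(kronSum n M)⁻¹ ⟨k - 1, by omega⟩ ⟨t - 1, by omega⟩| ≤
      (Real.sqrt (κ ^ 2 + 1) / (2 * lammin)) * (1 / Real.sqrt 𝔫) := by
  have hlam : 0 < lammin := by
    obtain ⟨p, hp⟩ := hmin.1
    exact hp ▸ hM.eigenvalues_pos p
  have hκ1 : 1 ≤ κ := by rw [hκ, one_le_div hlam]; exact hlt.le
  have hspec : M = hM.1.eigenvectorUnitary * diagonal hM.1.eigenvalues *
      star (hM.1.eigenvectorUnitary : Matrix (Fin n) (Fin n) ℝ) := hM.1.spectral_theorem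
  have hU := hM.1.eigenvectorUnitary.2
  let δ : Fin n × Fin n → Fin n × Fin n → ℤ := fun x y =>
    |(x.1 : ℤ) - y.1| + |(x.2 : ℤ) - y.2|
  have hself (x) : δ x x = 0 := by simp [δ]
  have htriangle (x y z) : δ x z ≤ δ x y + δ y z := by
    have h1 := abs_sub_le (x.1 : ℤ) y.1 z.1
    have h2 := abs_sub_le (x.2 : ℤ) y.2 z.2
    simp only [δ]
    linarith
  have hband (x y : Fin n × Fin n) (hxy : 1 < δ x y) :
      (1 ⊗ₖ M + M ⊗ₖ 1 : Matrix (Fin n × Fin n) (Fin n × Fin n) ℝ) x y = 0 := by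
    simp only [Matrix.add_apply, kroneckerMap_apply, one_apply]
    have h1 : (if x.1 = y.1 then (1 : ℝ) else 0) * M x.2 y.2 = 0 := by
      split_ifs with h
      · rw [htri, mul_zero]
        simpa [δ, h] using hxy
      · rw [zero_mul]
    have h2 : M x.1 y.1 * (if x.2 = y.2 then (1 : ℝ) else 0) = 0 := by
      split_ifs with h
      · rw [htri, zero_mul]
        simpa [δ, h] using hxy
      · rw [mul_zero]
    rw [h1, h2, add_zero]
  have hspectrum (p : Fin n × Fin n) : hM.1.eigenvalues p.2 + hM.1.eigenvalues p.1 ∈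
      Set.Icc (2 * lammin) (2 * lammax) := by
    have l1 := hmin.2 ⟨p.1, rfl⟩
    have l2 := hmin.2 ⟨p.2, rfl⟩
    have u1 := hmax.2 ⟨p.1, rfl⟩
    have u2 := hmax.2 ⟨p.2, rfl⟩
    constructor <;> linarith
  have hl' : ℓ = (k - 1) % n + 1 := by
    have := Nat.mod_add_div (k - 1) n
    omega
  have hi' : i = (t - 1) % n + 1 := by
    have := Nat.mod_add_div (t - 1) n
    omega
  set x := finProdFinEquiv.symm (⟨k - 1, by omega⟩ : Fin (n * n)) with hx
  set y := finProdFinEquiv.symm (⟨t - 1, by omega⟩ : Fin (n * n)) with hy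
  have hδ : δ x y = |(m : ℤ) - j| + |(ℓ : ℤ) - i| := by
    rw [hl', hi', hm, hj]
    simp [δ, hx, hy, Fin.coe_divNat, Fin.coe_modNat]
  have hbound := abs_inv_apply_le_of_banded hself htriangle hband
    (kronecker_mem_unitary hU hU) (kroneckerSum_eq_conj_diagonal hU hspec)
    (by positivity) hspectrum x y (δ x y).toNat
    (Int.toNat_of_nonneg (by positivity)).le
  have hd : (((δ x y).toNat : ℕ) : ℝ) = 𝔫 + 2 := by
    have hcast : (((δ x y).toNat : ℤ) : ℝ) = ((δ x y : ℤ) : ℝ) := by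
      rw [Int.toNat_of_nonneg (by positivity)]
    rw [Int.cast_natCast] at hcast
    rw [hcast, hδ, h𝔫]
    push_cast
    ring
  have hratio : (2 * lammax - 2 * lammin) / (2 * lammax + 2 * lammin) = (κ - 1) / (κ + 1) := by
    have : 0 < lammax := hlam.trans hlt
    rw [hκ]
    field_simp
  rw [hratio] at hbound
  rw [kronSum_eq_submatrix, inv_submatrix_equiv, submatrix_apply]
  refine hbound.trans ?_
  rw [div_mul_div_comm, mul_one, mul_comm (2 * lammin), ← div_div (√(κ ^ 2 + 1))]
  gcongr
  rw [le_div_iff₀ (Real.sqrt_pos.mpr h𝔫pos)]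
  refine le_trans ?_ (pow_mul_sqrt_le hκ1 (δ x y).toNat)
  have : 0 ≤ (κ - 1) / (κ + 1) := div_nonneg (by linarith) (by linarith)
  gcongr
  linarith
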